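/- If a stratified space X over a poset P is categorically fibrant and refined, then X_p ⊆ cl(X_q) for all p ≤ q in P; in particular, X has path-connected strata and is frontier stratified. -/

import Mathlib

open Set unitInterval

noncomputable section

/-! ### Stratified spaces over a poset -/

/-- Continuity into the Alexandrov topology on a preordered set: preimages of
upper sets are open. -/
def AlexContinuous {P : Type*} [Preorder P] {X : Type*} [TopologicalSpace X] (s : X → P) : Prop :=
  ∀ U : Set P, IsUpperSet U → IsOpen (s ⁻¹' U)

lemma stdSimplex.exists_pos' {n : ℕ} (x : stdSimplex ℝ (Fin (n + 1))) :
    ∃ i, 0 < (x : Fin (n + 1) → ℝ) i := by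
  by_contra h
  push_neg at h
  have h1 : ∑ i, (x : Fin (n + 1) → ℝ) i = 1 := x.2.2
  have h2 : ∑ i, (x : Fin (n + 1) → ℝ) i ≤ 0 := Finset.sum_nonpos fun i _ => h i
  linarith

/-- The largest index with positive barycentric coordinate. -/
def maxSupp {n : ℕ} (x : stdSimplex ℝ (Fin (n + 1))) : Fin (n + 1) :=
  (Finset.univ.filter fun i => 0 < (x : Fin (n + 1) → ℝ) i).max' (by
    obtain ⟨i, hi⟩ := stdSimplex.exists_pos' x
    exact ⟨i, Finset.mem_filter.2 ⟨Finset.mem_univ i, hi⟩⟩)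

/-- The stratification of the realized stratified simplex `|Δ^J|` of a flag `J`. -/
def flagStrat {P : Type*} {n : ℕ} (J : Fin (n + 1) → P) (x : stdSimplex ℝ (Fin (n + 1))) : P :=
  J (maxSupp x)

/-- The `k`-th horn of the standard `n`-simplex, as a subset of the simplex. -/
def hornSet (n : ℕ) (k : Fin (n + 1)) : Set (stdSimplex ℝ (Fin (n + 1))) :=
  {x | ∃ i, i ≠ k ∧ (x : Fin (n + 1) → ℝ) i = 0}

/-- `X` (stratified by `s`) has the horn filling property with respect to the
realized stratified horn inclusion `|Λ^J_k| ↪ |Δ^J|`. -/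
def HornFilling {P : Type*} {X : Type*} [TopologicalSpace X] (s : X → P) {n : ℕ}
    (J : Fin (n + 1) → P) (k : Fin (n + 1)) : Prop :=
  ∀ f : hornSet n k → X, Continuous f →
    (∀ y : hornSet n k, s (f y) = flagStrat J y.1) →
    ∃ g : stdSimplex ℝ (Fin (n + 1)) → X, Continuous g ∧
      (∀ x, s (g x) = flagStrat J x) ∧ ∀ y : hornSet n k, g y.1 = f y

/-- `(J, k)` is an inner horn datum. -/
def IsInner (n : ℕ) (k : Fin (n + 1)) : Prop := 0 < (k : ℕ) ∧ (k : ℕ) < n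

/-- `(J, k)` is an admissible horn datum. -/
def IsAdmissible {P : Type*} {n : ℕ} (J : Fin (n + 1) → P) (k : Fin (n + 1)) : Prop :=
  IsInner n k ∨
    ((k : ℕ) = 0 ∧ ∃ h : 0 < n, J ⟨0, Nat.succ_pos n⟩ = J ⟨1, Nat.succ_lt_succ h⟩) ∨
    ((k : ℕ) = n ∧ ∃ _h : 0 < n, J ⟨n - 1, by omega⟩ = J ⟨n, Nat.lt_succ_self n⟩)

/-- A stratified space is categorically fibrant if it has the horn filling property
with respect to all inner stratified horn inclusions. -/
def CatFibrant {P : Type*} [Preorder P] {X : Type*} [TopologicalSpace X] (s : X → P) : Prop :=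
  ∀ (n : ℕ) (J : Fin (n + 1) → P), Monotone J → ∀ k : Fin (n + 1), IsInner n k → HornFilling s J k

/-- A stratified space is diagrammatically fibrant if it has the horn filling property
with respect to all admissible stratified horn inclusions. -/
def DiagFibrant {P : Type*} [Preorder P] {X : Type*} [TopologicalSpace X] (s : X → P) : Prop :=
  ∀ (n : ℕ) (J : Fin (n + 1) → P), Monotone J → ∀ k : Fin (n + 1), IsAdmissible J k →
    HornFilling s J k

/-! ### Exit paths and refinedness -/

/-- An exit path: `s ∘ γ` is constant on `(0, 1]` and does not decrease from `γ 0`. -/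
def IsExitPath {P : Type*} [Preorder P] {X : Type*} [TopologicalSpace X]
    (s : X → P) (γ : C(I, X)) : Prop :=
  (∀ t t' : I, t ≠ 0 → t' ≠ 0 → s (γ t) = s (γ t')) ∧ ∀ t : I, s (γ 0) ≤ s (γ t)

/-- One step in a chain of exit paths. -/
def ExitStep {P : Type*} [Preorder P] {X : Type*} [TopologicalSpace X] (s : X → P)
    (x y : X) : Prop :=
  ∃ γ : C(I, X), IsExitPath s γ ∧ γ 0 = x ∧ γ 1 = y

/-- A stratified space is refined if its stratification is surjective and the order
relation is exactly detected by finite chains of exit paths. -/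
def IsRefined {P : Type*} [Preorder P] {X : Type*} [TopologicalSpace X] (s : X → P) : Prop :=
  Function.Surjective s ∧ ∀ x y : X, s x ≤ s y ↔ Relation.ReflTransGen (ExitStep s) x y

/-- The frontier relation: the `p`-stratum meets the closure of the `q`-stratum. -/
def FrontierRel {P : Type*} {X : Type*} [TopologicalSpace X] (s : X → P) (p q : P) : Prop :=
  (s ⁻¹' {p} ∩ closure (s ⁻¹' {q})).Nonempty

/-- Weakly frontier stratified. -/
def WeaklyFrontierStratified {P : Type*} [Preorder P] {X : Type*} [TopologicalSpace X]
    (s : X → P) : Prop :=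
  Function.Surjective s ∧ ∀ p q : P, p ≤ q ↔ Relation.ReflTransGen (FrontierRel s) p q

/-- Frontier stratified. -/
def FrontierStratified {P : Type*} [Preorder P] {X : Type*} [TopologicalSpace X]
    (s : X → P) : Prop :=
  WeaklyFrontierStratified s ∧ ∀ p q : P, FrontierRel s p q → s ⁻¹' {p} ⊆ closure (s ⁻¹' {q})

/-! ### Homotopy links -/

lemma I_one_ne_zero : (1 : I) ≠ 0 := fun h => one_ne_zero (α := ℝ) (congrArg Subtype.val h)

/-- The pairwise homotopy link of the pair of strata `p`, `q`. -/
abbrev PairHolink {P : Type*} {X : Type*} [TopologicalSpace X] (s : X → P) (p q : P) :=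
  {γ : C(I, X) // s (γ 0) = p ∧ ∀ t : I, t ≠ 0 → s (γ t) = q}

/-- Starting point evaluation on the pairwise homotopy link. -/
def pairHolinkEv0 {P : Type*} {X : Type*} [TopologicalSpace X] (s : X → P) (p q : P)
    (γ : PairHolink s p q) : {x : X // s x = p} :=
  ⟨γ.1 0, γ.2.1⟩

/-- A Serre fibration: a map with the homotopy lifting property with respect to all
Euclidean disks. -/
def IsSerreFibration {E B : Type*} [TopologicalSpace E] [TopologicalSpace B] (π : E → B) : Prop :=
  ∀ (n : ℕ)
    (H : ↥(Metric.closedBall (0 : EuclideanSpace ℝ (Fin n)) 1) × I → B)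
    (h₀ : ↥(Metric.closedBall (0 : EuclideanSpace ℝ (Fin n)) 1) → E),
    Continuous H → Continuous h₀ → (∀ d, π (h₀ d) = H (d, 0)) →
    ∃ G : ↥(Metric.closedBall (0 : EuclideanSpace ℝ (Fin n)) 1) × I → E,
      Continuous G ∧ (∀ d, G (d, 0) = h₀ d) ∧ ∀ z, π (G z) = H z

/-- The stratified homotopy link of the stratum `p`: exit paths starting in the
`p`-stratum and immediately leaving it. -/
abbrev StratHolink {P : Type*} [Preorder P] {X : Type*} [TopologicalSpace X]
    (s : X → P) (p : P) :=
  {γ : C(I, X) // s (γ 0) = p ∧ (∀ t : I, t ≠ 0 → p < s (γ t)) ∧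
    ∀ t t' : I, t ≠ 0 → t' ≠ 0 → s (γ t) = s (γ t')}

/-- The stratification of the stratified homotopy link over `P_{>p}`. -/
def stratHolinkStrat {P : Type*} [Preorder P] {X : Type*} [TopologicalSpace X]
    (s : X → P) (p : P) (γ : StratHolink s p) : {q : P // p < q} :=
  ⟨s (γ.1 1), γ.2.2.1 1 I_one_ne_zero⟩

/-- Endpoint evaluation on the stratified homotopy link. -/
def stratHolinkEv1 {P : Type*} [Preorder P] {X : Type*} [TopologicalSpace X]
    (s : X → P) (p : P) (γ : StratHolink s p) : {x : X // p < s x} :=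
  ⟨γ.1 1, γ.2.2.1 1 I_one_ne_zero⟩

/-- The generalized homotopy link of a (regular) flag `Iflag`: the space of stratified
maps `|Δ^Iflag| → X`, topologized via the compact-open topology. -/
abbrev Holink {P : Type*} {X : Type*} [TopologicalSpace X] (s : X → P) {m : ℕ}
    (Iflag : Fin (m + 1) → P) :=
  {f : C(stdSimplex ℝ (Fin (m + 1)), X) // ∀ x, s (f x) = flagStrat Iflag x}

/-! ### Weak homotopy equivalences -/

/-- The boundary of the `n`-cube. -/
def cubeBoundary (n : ℕ) : Set (Fin n → I) := {y | ∃ i, y i = 0 ∨ y i = 1}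

/-- Generalized loops: maps of the `n`-cube collapsing the boundary to the basepoint. -/
abbrev GenLoops (n : ℕ) (X : Type*) [TopologicalSpace X] (x : X) :=
  {p : C((Fin n → I), X) // ∀ y ∈ cubeBoundary n, p y = x}

/-- Homotopy rel boundary as a setoid on generalized loops. -/
def genLoopSetoid (n : ℕ) (X : Type*) [TopologicalSpace X] (x : X) :
    Setoid (GenLoops n X x) where
  r p q := p.1.HomotopicRel q.1 (cubeBoundary n)
  iseqv := ⟨fun p => ContinuousMap.HomotopicRel.refl p.1,
    fun h => h.symm, fun h h' => h.trans h'⟩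

/-- The `n`-th homotopy group (as a type) of `X` at `x`. -/
def HtpyGroup (n : ℕ) (X : Type*) [TopologicalSpace X] (x : X) :=
  Quotient (genLoopSetoid n X x)

/-- The map induced by a continuous map on homotopy groups. -/
def htpyGroupMap (n : ℕ) {X Y : Type*} [TopologicalSpace X] [TopologicalSpace Y]
    (f : C(X, Y)) (x : X) : HtpyGroup n X x → HtpyGroup n Y (f x) :=
  Quotient.map (fun p => ⟨f.comp p.1, fun y hy => by
      simp [ContinuousMap.comp_apply, p.2 y hy]⟩)
    (fun p q h => h.map fun F => F.compContinuousMap f)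

/-- The map induced by a continuous map on path components. -/
def pi0Map {X Y : Type*} [TopologicalSpace X] [TopologicalSpace Y] (f : C(X, Y)) :
    ZerothHomotopy X → ZerothHomotopy Y :=
  Quotient.map f fun _ _ h => ⟨h.somePath.map f.continuous⟩

/-- A weak homotopy equivalence: a continuous map inducing a bijection on path
components and isomorphisms on all homotopy groups at all basepoints. -/
def IsWeakHomotopyEquiv {X Y : Type*} [TopologicalSpace X] [TopologicalSpace Y]
    (f : C(X, Y)) : Prop :=
  Function.Bijective (pi0Map f) ∧
    ∀ (n : ℕ) (x : X), Function.Bijective (htpyGroupMap (n + 1) f x)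

/-! ### Induced maps and diagrammatic equivalences -/

/-- The map induced on generalized homotopy links by a stratified map. -/
def holinkCMap {P : Type*} {X Y : Type*} [TopologicalSpace X] [TopologicalSpace Y]
    (sX : X → P) (sY : Y → P) (w : C(X, Y)) (hw : ∀ x, sY (w x) = sX x)
    {m : ℕ} (Iflag : Fin (m + 1) → P) :
    C(Holink sX Iflag, Holink sY Iflag) :=
  ⟨fun f => ⟨w.comp f.1, fun x => by simp [ContinuousMap.comp_apply, hw, f.2 x]⟩,
    Continuous.subtype_mk
      ((ContinuousMap.continuous_postcomp w).comp continuous_subtype_val) _⟩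

/-- A stratified map is a diagrammatic equivalence if it induces weak homotopy
equivalences on all generalized homotopy links. -/
def IsDiagEquiv {P : Type*} [Preorder P] {X Y : Type*} [TopologicalSpace X] [TopologicalSpace Y]
    (sX : X → P) (sY : Y → P) (w : C(X, Y)) (hw : ∀ x, sY (w x) = sX x) : Prop :=
  ∀ (m : ℕ) (Iflag : Fin (m + 1) → P), StrictMono Iflag →
    IsWeakHomotopyEquiv (holinkCMap sX sY w hw Iflag)

/-- The restriction of a stratified map to the `q`-stratum. -/
def stratumCMap {Q : Type*} {X Y : Type*} [TopologicalSpace X] [TopologicalSpace Y]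
    (sX : X → Q) (sY : Y → Q) (w : C(X, Y)) (hw : ∀ x, sY (w x) = sX x) (q : Q) :
    C({x : X // sX x = q}, {y : Y // sY y = q}) :=
  ⟨fun x => ⟨w x.1, by rw [hw x.1]; exact x.2⟩,
    Continuous.subtype_mk (w.continuous.comp continuous_subtype_val)
      fun x => by show sY (w x.1) = q; rw [hw x.1]; exact x.2⟩

/-- The map induced on stratified homotopy links by a stratified map. -/
def stratHolinkCMap {P : Type*} [Preorder P] {X Y : Type*} [TopologicalSpace X]
    [TopologicalSpace Y] {sX : X → P} {sY : Y → P} (w : C(X, Y))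
    (hw : ∀ x, sY (w x) = sX x) (p : P) :
    C(StratHolink sX p, StratHolink sY p) :=
  ⟨fun γ => ⟨w.comp γ.1,
      by simpa [ContinuousMap.comp_apply, hw] using γ.2.1,
      fun t ht => by simpa [ContinuousMap.comp_apply, hw] using γ.2.2.1 t ht,
      fun t t' ht ht' => by simpa [ContinuousMap.comp_apply, hw] using γ.2.2.2 t t' ht ht'⟩,
    Continuous.subtype_mk
      ((ContinuousMap.continuous_postcomp w).comp continuous_subtype_val) _⟩

lemma stratHolinkCMap_strat {P : Type*} [Preorder P] {X Y : Type*} [TopologicalSpace X]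
    [TopologicalSpace Y] {sX : X → P} {sY : Y → P} (w : C(X, Y))
    (hw : ∀ x, sY (w x) = sX x) (p : P) (γ : StratHolink sX p) :
    stratHolinkStrat sY p (stratHolinkCMap w hw p γ) = stratHolinkStrat sX p γ :=
  Subtype.ext (hw _)

/-- The local homotopy link of `X` at `x ∈ X_p`: the fiber of the stratified homotopy
link over `x`. -/
abbrev LocalHolink {P : Type*} [Preorder P] {X : Type*} [TopologicalSpace X]
    (s : X → P) (p : P) (x : X) :=
  {γ : StratHolink s p // (γ.1 : C(I, X)) 0 = x}

/-- The stratification of the local homotopy link over `P_{>p}`. -/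
def localHolinkStrat {P : Type*} [Preorder P] {X : Type*} [TopologicalSpace X]
    (s : X → P) (p : P) (x : X) (γ : LocalHolink s p x) : {q : P // p < q} :=
  stratHolinkStrat s p γ.1

/-- The map induced on local homotopy links by a stratified map. -/
def localHolinkCMap {P : Type*} [Preorder P] {X Y : Type*} [TopologicalSpace X]
    [TopologicalSpace Y] {sX : X → P} {sY : Y → P} (w : C(X, Y))
    (hw : ∀ x, sY (w x) = sX x) (p : P) (x : X) :
    C(LocalHolink sX p x, LocalHolink sY p (w x)) :=
  ⟨fun γ => ⟨stratHolinkCMap w hw p γ.1, by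
      show (w.comp γ.1.1) 0 = w x
      simp [ContinuousMap.comp_apply, γ.2]⟩,
    Continuous.subtype_mk
      ((stratHolinkCMap w hw p).continuous.comp continuous_subtype_val)
      fun γ => by
        show (w.comp γ.1.1) 0 = w x
        simp [ContinuousMap.comp_apply, γ.2]⟩

lemma localHolinkCMap_strat {P : Type*} [Preorder P] {X Y : Type*} [TopologicalSpace X]
    [TopologicalSpace Y] {sX : X → P} {sY : Y → P} (w : C(X, Y))
    (hw : ∀ x, sY (w x) = sX x) (p : P) (x : X) (γ : LocalHolink sX p x) :
    localHolinkStrat sY p (w x) (localHolinkCMap w hw p x γ) = localHolinkStrat sX p x γ :=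
  Subtype.ext (hw _)

end

open Topology

lemma maxSupp_eq_of_pos_of_forall_lt {n : ℕ} {x : stdSimplex ℝ (Fin (n + 1))} {i : Fin (n + 1)}
    (hi : 0 < (x : Fin (n + 1) → ℝ) i) (h : ∀ j, i < j → (x : Fin (n + 1) → ℝ) j = 0) :
    maxSupp x = i := by
  refine le_antisymm (Finset.max'_le _ _ _ fun j hj => ?_) (Finset.le_max' _ _ (by simpa using hi))
  by_contra! hij
  exact (Finset.mem_filter.1 hj).2.ne' (h j hij)

/-- Exit paths can be composed by filling the inner horn of a stratified triangle. -/
lemma ExitStep.trans {P X : Type*} [Preorder P] [TopologicalSpace X] {s : X → P}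
    (hfib : CatFibrant s) {x y z : X} (hxy : ExitStep s x y) (hyz : ExitStep s y z) :
    ExitStep s x z := by
  obtain ⟨γ, ⟨hγ, hγ'⟩, hγ0, hγ1⟩ := hxy
  obtain ⟨δ, ⟨hδ, hδ'⟩, hδ0, hδ1⟩ := hyz
  have hle₁ : s x ≤ s y := by simpa only [hγ0, hγ1] using hγ' 1
  have hle₂ : s y ≤ s z := by simpa only [hδ0, hδ1] using hδ' 1
  have hγpos (t : I) (ht : t ≠ 0) : s (γ t) = s y := hγ1 ▸ hγ t 1 ht I_one_ne_zero
  have hδpos (t : I) (ht : t ≠ 0) : s (δ t) = s z := hδ1 ▸ hδ t 1 ht I_one_ne_zero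
  let J : Fin 3 → P := ![s x, s y, s z]
  have hJ : Monotone J := Fin.monotone_iff_le_succ.2 fun i => by
    fin_cases i
    exacts [hle₁, hle₂]
  let a : Path x y := ⟨γ, hγ0, hγ1⟩
  let b : Path y z := ⟨δ, hδ0, hδ1⟩
  have hsum (w : stdSimplex ℝ (Fin 3)) : w.1 0 + w.1 1 + w.1 2 = 1 := by
    rw [← w.2.2, Fin.sum_univ_three]
  have hnn (w : stdSimplex ℝ (Fin 3)) (i : Fin 3) : 0 ≤ w.1 i := w.2.1 i
  let f : stdSimplex ℝ (Fin 3) → X := fun w => (a.trans b).extend ((w.1 1 + 2 * w.1 2) / 2)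
  have hf : Continuous f := by
    have hc (i : Fin 3) : Continuous fun w : stdSimplex ℝ (Fin 3) => w.1 i :=
      (continuous_apply i).comp continuous_subtype_val
    exact (a.trans b).continuous_extend.comp
      (((hc 1).add (continuous_const.mul (hc 2))).div_const 2)
  have hf_first (w : stdSimplex ℝ (Fin 3)) (h : w.1 2 = 0) :
      f w = γ ⟨w.1 1, hnn w 1, by linarith [hsum w, hnn w 0]⟩ := by
    have h1 : w.1 1 ≤ 1 := by linarith [hsum w, hnn w 0]
    have hI : w.1 1 / 2 ∈ I := ⟨by linarith [hnn w 1], by linarith⟩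
    simp only [f, h, mul_zero, add_zero]
    rw [Path.extend_apply _ hI, Path.trans_apply, dif_pos (by simp only; linarith)]
    exact congrArg γ (Subtype.ext (by simp only; ring))
  have hf_last (w : stdSimplex ℝ (Fin 3)) (h : w.1 0 = 0) :
      f w = δ ⟨w.1 2, hnn w 2, by linarith [hsum w, hnn w 1]⟩ := by
    have h1 : w.1 1 = 1 - w.1 2 := by linarith [hsum w]
    have h2 : (w.1 1 + 2 * w.1 2) / 2 = (1 + w.1 2) / 2 := by rw [h1]; ring
    have hI : (1 + w.1 2) / 2 ∈ I := ⟨by linarith [hnn w 2], by linarith [hnn w 1]⟩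
    simp only [f]
    rw [h2, Path.extend_apply _ hI, Path.trans_apply]
    split_ifs with hh
    · have hw : w.1 2 = 0 := by simp only at hh; linarith [hnn w 2]
      have : δ ⟨w.1 2, hnn w 2, by linarith [hsum w, hnn w 1]⟩ = y := by
        rw [← hδ0]; exact congrArg δ (Subtype.ext hw)
      rw [this]
      exact Eq.trans (congrArg γ (Subtype.ext (by simp [hw]))) hγ1
    · exact congrArg δ (Subtype.ext (by simp only; ring))
  obtain ⟨g, hg, hgs, hgf⟩ := hfib 2 J hJ 1 ⟨by simp, by simp⟩ (fun w => f w.1)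
    (hf.comp continuous_subtype_val) (by
      rintro ⟨w, i, hi, hw⟩
      have hw : w.1 i = 0 := hw
      change s (f w) = J (maxSupp w)
      by_cases h2 : w.1 2 = 0
      · rw [hf_first w h2]
        by_cases h1 : w.1 1 = 0
        · rw [maxSupp_eq_of_pos_of_forall_lt (i := 0) (by change 0 < w.1 0; linarith [hsum w])
            (fun j hj => by fin_cases j; exacts [absurd hj (lt_irrefl _), h1, h2])]
          exact congrArg s (hγ0 ▸ congrArg γ (Subtype.ext h1))
        · rw [maxSupp_eq_of_pos_of_forall_lt (i := 1) (lt_of_le_of_ne (hnn w 1) (Ne.symm h1))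
            (fun j hj => by fin_cases j; exacts [absurd hj (by decide), absurd hj (by decide), h2])]
          exact hγpos _ fun h => h1 (congrArg Subtype.val h)
      · have h0 : w.1 0 = 0 := by
          fin_cases i
          exacts [hw, absurd rfl hi, absurd hw h2]
        rw [hf_last w h0, maxSupp_eq_of_pos_of_forall_lt (i := 2)
          (lt_of_le_of_ne (hnn w 2) (Ne.symm h2)) (fun j hj => absurd hj (Fin.le_last j).not_gt)]
        exact hδpos _ fun h => h2 (congrArg Subtype.val h))
  let e : I → stdSimplex ℝ (Fin 3) := fun t => ⟨![1 - t, 0, t],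
    fun i => by fin_cases i <;> simp [t.2.1, t.2.2], by simp [Fin.sum_univ_three]⟩
  have he : Continuous e := by
    refine Continuous.subtype_mk (continuous_pi fun i => ?_) _
    fin_cases i <;> simp <;> fun_prop
  have he0 : g (e 0) = x := by
    rw [hgf ⟨e 0, 2, by decide, rfl⟩]
    simp only
    rw [hf_first _ rfl, ← hγ0]
    exact congrArg γ (Subtype.ext rfl)
  have he1 : g (e 1) = z := by
    rw [hgf ⟨e 1, 0, by decide, sub_self 1⟩]
    simp only
    rw [hf_last _ (sub_self 1), ← hδ1]
    exact congrArg δ (Subtype.ext rfl)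
  have hepos (t : I) (ht : t ≠ 0) : s (g (e t)) = s z := by
    rw [hgs, flagStrat, maxSupp_eq_of_pos_of_forall_lt (x := e t) (i := 2)
      (show 0 < (t : ℝ) from unitInterval.pos_iff_ne_zero.2 ht)
      (fun j hj => absurd hj (Fin.le_last j).not_gt)]
    rfl
  refine ⟨⟨fun t => g (e t), hg.comp he⟩, ⟨fun t t' ht ht' => ?_, fun t => ?_⟩, he0, he1⟩
  · exact (hepos t ht).trans (hepos t' ht').symm
  · change s (g (e 0)) ≤ s (g (e t))
    by_cases ht : t = 0
    · rw [ht]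
    · rw [he0, hepos t ht]
      exact hle₁.trans hle₂

lemma ExitStep.refl {P X : Type*} [Preorder P] [TopologicalSpace X] (s : X → P) (x : X) :
    ExitStep s x x :=
  ⟨ContinuousMap.const I x, ⟨fun _ _ _ _ => rfl, fun _ => le_rfl⟩, rfl, rfl⟩

/-- In a refined categorically fibrant space, a single exit path detects the order. -/
lemma exitStep_of_le {P X : Type*} [Preorder P] [TopologicalSpace X] {s : X → P}
    (hfib : CatFibrant s) (href : IsRefined s) {x y : X} (h : s x ≤ s y) : ExitStep s x y := by
  induction (href.2 x y).1 h with
  | refl => exact ExitStep.refl s x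
  | tail hab hbc ih => exact (ih ((href.2 _ _).2 hab)).trans hfib hbc

lemma FrontierRel.le {P X : Type*} [Preorder P] [TopologicalSpace X] {s : X → P}
    (hs : AlexContinuous s) {p q : P} (h : FrontierRel s p q) : p ≤ q := by
  obtain ⟨x, hx, hxq⟩ := h
  obtain ⟨y, hy, hyq⟩ := mem_closure_iff.1 hxq _ (hs (Ici p) (isUpperSet_Ici p)) (ge_of_eq hx)
  exact le_of_le_of_eq hy hyq

lemma ExitStep.mem_closure {P X : Type*} [Preorder P] [TopologicalSpace X] {s : X → P}
    {x y : X} (h : ExitStep s x y) : x ∈ closure (s ⁻¹' {s y}) := by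
  obtain ⟨γ, hγ, rfl, rfl⟩ := h
  have h0 : (0 : I) ∈ closure {(0 : I)}ᶜ := by
    have : (𝓝[≠] (0 : I)).NeBot := inferInstance
    exact mem_closure_iff_nhdsWithin_neBot.2 this
  exact γ.continuous.continuousAt.continuousWithinAt.mem_closure h0
    fun t ht => hγ.1 t 1 ht I_one_ne_zero

/-- If a stratified space is categorically fibrant and refined, then `X_p ⊆ cl(X_q)`
for all `p ≤ q`; in particular it has path-connected strata and is frontier
stratified. -/
theorem catFibrant_refined_implies_frontier {P : Type} [PartialOrder P] {X : Type}
    [TopologicalSpace X] (s : X → P) (hs : AlexContinuous s)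
    (hfib : CatFibrant s) (href : IsRefined s) :
    (∀ p q : P, p ≤ q → s ⁻¹' {p} ⊆ closure (s ⁻¹' {q})) ∧
      (∀ p : P, IsPathConnected (s ⁻¹' {p})) ∧ FrontierStratified s := by
  have hcl (p q : P) (hpq : p ≤ q) : s ⁻¹' {p} ⊆ closure (s ⁻¹' {q}) := by
    rintro x rfl
    obtain ⟨y, rfl⟩ := href.1 q
    exact (exitStep_of_le hfib href hpq).mem_closure
  refine ⟨hcl, fun p => ?_, ⟨href.1, fun p q => ⟨fun hpq => ?_, fun h => ?_⟩⟩,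
    fun p q h => hcl p q (h.le hs)⟩
  · obtain ⟨x, rfl⟩ := href.1 p
    refine ⟨x, rfl, fun {y} hy => ?_⟩
    have hy : s y = s x := hy
    obtain ⟨γ, hγ, hγ0, hγ1⟩ := exitStep_of_le hfib href hy.ge
    refine ⟨⟨γ, hγ0, hγ1⟩, fun t => ?_⟩
    change s (γ t) = s x
    by_cases ht : t = 0
    · rw [ht, hγ0]
    · rw [hγ.1 t 1 ht I_one_ne_zero, hγ1, hy]
  · obtain ⟨x, hx⟩ := href.1 p
    exact .single ⟨x, hx, hcl p q hpq hx⟩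
  · induction h with
    | refl => exact le_rfl
    | tail _ hbc ih => exact ih.trans (hbc.le hs)
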